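/- arXiv:1802.05809 — 2 statements merged into one kernel-verified Lean document; each statement's English description precedes it below -/
import Mathlib

section
/- Assume the eikonal setting: Ω : ℝ × ℝ → ℝ is continuous and C¹ in (t,ξ) with partial derivative Ω_ξ in the second argument; s ∈ {−1,1} and κ ∈ ℝ are fixed; φ : ℝ × ℝ → ℝ is C² in (x,t) and satisfies φ_t(x,t) = s·Ω(t, κ − φ_x(x,t)) for all (x,t). Let x : ℝ → ℝ be differentiable with x'(t) = s·Ω_ξ(t, κ − φ_x(x(t),t)) for all t, and set σ := x(0) and g' := φ_x(σ, 0). Then for all t ≥ 0: x(t) = σ + s·∫₀ᵗ Ω_ξ(τ, κ − g') dτ and φ(x(t), t) = φ(σ, 0) + s·∫₀ᵗ [g'·Ω_ξ(τ, κ − g') + Ω(τ, κ − g')] dτ. -/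
open MeasureTheory

/-- Partial derivative in the first variable, in terms of the Fréchet derivative. -/
lemma hasDerivAt_partial_fst {f : ℝ → ℝ → ℝ} {x y : ℝ}
    (hf : DifferentiableAt ℝ (fun p : ℝ × ℝ => f p.1 p.2) (x, y)) :
    HasDerivAt (fun x' => f x' y) (fderiv ℝ (fun p : ℝ × ℝ => f p.1 p.2) (x, y) (1, 0)) x :=
  hf.hasFDerivAt.comp_hasDerivAt (f := fun x' => (x', y)) x ((hasDerivAt_id x).prodMk (hasDerivAt_const x y))

/-- Partial derivative in the second variable, in terms of the Fréchet derivative. -/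
lemma hasDerivAt_partial_snd {f : ℝ → ℝ → ℝ} {x y : ℝ}
    (hf : DifferentiableAt ℝ (fun p : ℝ × ℝ => f p.1 p.2) (x, y)) :
    HasDerivAt (fun y' => f x y') (fderiv ℝ (fun p : ℝ × ℝ => f p.1 p.2) (x, y) (0, 1)) y :=
  hf.hasFDerivAt.comp_hasDerivAt y ((hasDerivAt_const y x).prodMk (hasDerivAt_id y))

/-- The spatial derivative of a solution of the eikonal equation is constant along
characteristics. -/
lemma deriv_eq_along_characteristic
    {Ω : ℝ → ℝ → ℝ} (hΩ : Differentiable ℝ (fun p : ℝ × ℝ => Ω p.1 p.2)) {s κ : ℝ}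
    {φ : ℝ → ℝ → ℝ} (hφ : ContDiff ℝ 2 (fun p : ℝ × ℝ => φ p.1 p.2))
    (heik : ∀ x t : ℝ, deriv (fun t' => φ x t') t
      = s * Ω t (κ - deriv (fun x' => φ x' t) x))
    {X : ℝ → ℝ}
    (hX : ∀ t : ℝ, HasDerivAt X
      (s * deriv (fun ξ => Ω t ξ) (κ - deriv (fun x' => φ x' t) (X t))) t) (t₁ t₂ : ℝ) :
    deriv (fun x' => φ x' t₁) (X t₁) = deriv (fun x' => φ x' t₂) (X t₂) := by
  set F : ℝ × ℝ → ℝ := fun p => φ p.1 p.2 with hF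
  have hFd : Differentiable ℝ F := hφ.differentiable (by norm_num)
  have hx : ∀ x t, deriv (fun x' => φ x' t) x = fderiv ℝ F (x, t) (1, 0) := fun x t =>
    (hasDerivAt_partial_fst (hFd (x, t))).deriv
  have ht : ∀ x t, deriv (fun t' => φ x t') t = fderiv ℝ F (x, t) (0, 1) := fun x t =>
    (hasDerivAt_partial_snd (hFd (x, t))).deriv
  simp only [hx, ht] at heik hX ⊢
  have hL : Differentiable ℝ (fderiv ℝ F) :=
    (hφ.fderiv_right (m := 1) (by norm_num)).differentiable (by norm_num)
  have hdir : ∀ {γ : ℝ → ℝ × ℝ} {γ' : ℝ × ℝ} {r : ℝ} (v : ℝ × ℝ), HasDerivAt γ γ' r →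
      HasDerivAt (fun r => fderiv ℝ F (γ r) v) (fderiv ℝ (fderiv ℝ F) (γ r) γ' v) r := by
    intro γ γ' r v hγ
    have h := (hL (γ r)).hasFDerivAt.comp_hasDerivAt r hγ
    simpa using h.clm_apply (hasDerivAt_const r v)
  have hzero : ∀ t, HasDerivAt (fun t => fderiv ℝ F (X t, t) (1, 0)) 0 t := by
    intro t
    have h := hdir (1, 0) ((hX t).prodMk (hasDerivAt_id t))
    simp only [id] at h
    set D := fderiv ℝ (fderiv ℝ F) (X t, t)
    set w := deriv (fun ξ => Ω t ξ) (κ - fderiv ℝ F (X t, t) (1, 0)) with hw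
    have hcurve := (hasDerivAt_id (X t)).prodMk (hasDerivAt_const (X t) t)
    have hmixed : D (1, 0) (0, 1) = s * (w * -(D (1, 0) (1, 0))) := by
      have h₁ : HasDerivAt (fun x => fderiv ℝ F (x, t) (0, 1)) (D (1, 0) (0, 1)) (X t) :=
        hdir (0, 1) hcurve
      have h₂ : HasDerivAt (fun x => fderiv ℝ F (x, t) (1, 0)) (D (1, 0) (1, 0)) (X t) :=
        hdir (1, 0) hcurve
      have hΩξ : HasDerivAt (fun ξ => Ω t ξ) w (κ - fderiv ℝ F (X t, t) (1, 0)) :=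
        (hasDerivAt_partial_snd (hΩ (t, _))).differentiableAt.hasDerivAt
      have h₃ := (HasDerivAt.comp (X t) hΩξ (h₂.const_sub κ)).const_mul s
      simp only [heik] at h₁
      exact h₁.unique h₃
    have hsymm : D (s * w, 1) (1, 0) = D (1, 0) (s * w, 1) :=
      (hφ.contDiffAt.isSymmSndFDerivAt (by simp)).eq _ _
    have hsplit : ((s * w, 1) : ℝ × ℝ) = (s * w) • (1, 0) + (0, 1) := by simp
    have hval : D (s * w, 1) (1, 0) = 0 := by
      rw [hsymm, hsplit, map_add, map_smul, hmixed, smul_eq_mul]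
      ring
    rwa [hval] at h
  exact is_const_of_deriv_eq_zero (fun t => (hzero t).differentiableAt)
    (fun t => (hzero t).deriv) t₁ t₂

/-- formulas (34)–(35) of the paper: along a characteristic of the eikonal
equation `φ_t = s·Ω(t, κ − φ_x)`, with `σ := x(0)` and `g' := φ_x(σ,0)`, one has
`x(t) = σ + s·∫₀ᵗ Ω_ξ(τ, κ − g') dτ` and
`φ(x(t),t) = φ(σ,0) + s·∫₀ᵗ [g'·Ω_ξ(τ, κ − g') + Ω(τ, κ − g')] dτ` for `t ≥ 0`. -/
theorem stmt_5
    (Ω : ℝ → ℝ → ℝ) (hΩ : ContDiff ℝ 1 (fun p : ℝ × ℝ => Ω p.1 p.2))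
    (s : ℝ) (hs : s = 1 ∨ s = -1) (κ : ℝ)
    (φ : ℝ → ℝ → ℝ) (hφ : ContDiff ℝ 2 (fun p : ℝ × ℝ => φ p.1 p.2))
    (heik : ∀ x t : ℝ, deriv (fun t' => φ x t') t
      = s * Ω t (κ - deriv (fun x' => φ x' t) x))
    (X : ℝ → ℝ)
    (hX : ∀ t : ℝ, HasDerivAt X
      (s * deriv (fun ξ => Ω t ξ) (κ - deriv (fun x' => φ x' t) (X t))) t)
    (σ g' : ℝ) (hσ : σ = X 0) (hg : g' = deriv (fun x' => φ x' 0) σ) :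
    ∀ t : ℝ, 0 ≤ t →
      X t = σ + s * ∫ τ in (0 : ℝ)..t, deriv (fun ξ => Ω τ ξ) (κ - g')
      ∧ φ (X t) t = φ σ 0 + s * ∫ τ in (0 : ℝ)..t,
          (g' * deriv (fun ξ => Ω τ ξ) (κ - g') + Ω τ (κ - g')) := by
  intro t _
  have hΩd : Differentiable ℝ (fun p : ℝ × ℝ => Ω p.1 p.2) := hΩ.differentiable (by norm_num)
  have hφd : Differentiable ℝ (fun p : ℝ × ℝ => φ p.1 p.2) := hφ.differentiable (by norm_num)
  have hconst : ∀ τ, deriv (fun x' => φ x' τ) (X τ) = g' := fun τ => by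
    rw [hg, hσ]
    exact deriv_eq_along_characteristic hΩd hφ heik hX τ 0
  simp only [hconst] at hX
  have hcΩξ : Continuous fun τ => deriv (fun ξ => Ω τ ξ) (κ - g') := by
    simp only [fun τ => (hasDerivAt_partial_snd (hΩd (τ, κ - g'))).deriv]
    exact ((hΩ.continuous_fderiv (by norm_num)).comp
      (by fun_prop : Continuous fun τ : ℝ => (τ, κ - g'))).clm_apply continuous_const
  have hcΩ : Continuous fun τ => Ω τ (κ - g') :=
    hΩ.continuous.comp (by fun_prop : Continuous fun τ : ℝ => (τ, κ - g'))
  have hφX : ∀ τ, HasDerivAt (fun τ => φ (X τ) τ)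
      (s * (g' * deriv (fun ξ => Ω τ ξ) (κ - g') + Ω τ (κ - g'))) τ := by
    intro τ
    have h := (hφd (X τ, τ)).hasFDerivAt.comp_hasDerivAt (f := fun τ => (X τ, τ)) τ
      ((hX τ).prodMk (hasDerivAt_id τ))
    refine h.congr_deriv ?_
    set w := deriv (fun ξ => Ω τ ξ) (κ - g')
    have hsplit : ((s * w, 1) : ℝ × ℝ) = (s * w) • (1, 0) + (0, 1) := by simp
    rw [hsplit, map_add, map_smul, ← (hasDerivAt_partial_fst (hφd (X τ, τ))).deriv,
      ← (hasDerivAt_partial_snd (hφd (X τ, τ))).deriv, heik, hconst, smul_eq_mul]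
    ring
  have hX_int := intervalIntegral.integral_eq_sub_of_hasDerivAt (a := 0) (b := t)
    (fun τ _ => hX τ) ((continuous_const.mul hcΩξ).intervalIntegrable _ _)
  have hφ_int := intervalIntegral.integral_eq_sub_of_hasDerivAt (a := 0) (b := t)
    (fun τ _ => hφX τ)
    ((continuous_const.mul ((continuous_const.mul hcΩξ).add hcΩ)).intervalIntegrable _ _)
  rw [intervalIntegral.integral_const_mul] at hX_int hφ_int
  rw [hX_int, hφ_int, hσ]
  constructor <;> ring
end

section
/- Assume: Ω : ℝ × ℝ → ℝ is a C¹ function of (t,ξ) with partial derivative Ω_ξ in the second argument; s ∈ {−1,1}; φ : ℝ³ → ℝ is a C³ function of (x,t,κ) satisfying the eikonal equation ∂_tφ(x,t,κ) = s·Ω(t, κ − ∂_xφ(x,t,κ)) for all (x,t,κ). Let κ̂ : ℝ × ℝ → ℝ be differentiable and satisfy ∂_κφ(x,t,κ̂(x,t)) = x for all (x,t), with ∂_κ∂_κφ(x,t,κ̂(x,t)) ≠ 0 for all (x,t), and define the local wavenumber k̂(x,t) := κ̂(x,t) − ∂_xφ(x,t,κ̂(x,t)). Then for all (x,t): ∂_tk̂(x,t)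 + s·Ω_ξ(t, k̂(x,t))·∂_xk̂(x,t) = 0. -/
/-- Derivative along a curve of a directional derivative of a `C²` function. -/
theorem hasDerivAt_fderiv_apply_comp {E : Type*} [NormedAddCommGroup E] [NormedSpace ℝ E]
    {F : E → ℝ} (hF : ContDiff ℝ 2 F) {γ : ℝ → E} {v : E} {τ : ℝ}
    (hγ : HasDerivAt γ v τ) (w : E) :
    HasDerivAt (fun τ' => fderiv ℝ F (γ τ') w) (fderiv ℝ (fderiv ℝ F) (γ τ) v w) τ := by
  have hd : Differentiable ℝ (fderiv ℝ F) :=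
    (hF.fderiv_right (m := 1) (by norm_num)).differentiable (by norm_num)
  have h := (hd (γ τ)).hasFDerivAt.comp_hasDerivAt τ hγ
  simpa using h.clm_apply (hasDerivAt_const τ w)


/-- transport law (60) for the local wavenumber: if `φ(x,t,κ)` solves the
eikonal equation `∂_tφ = s·Ω(t, κ − ∂_xφ)`, the local quasimomentum `κ̂ = K(x,t)` satisfies
`∂_κφ(x,t,K(x,t)) = x` with `∂_κ∂_κφ ≠ 0`, and the local wavenumber is
`k̂(x,t) = K(x,t) − ∂_xφ(x,t,K(x,t))`, then `∂_tk̂ + s·Ω_ξ(t, k̂)·∂_xk̂ = 0`. -/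
theorem stmt_10
    (Ω : ℝ → ℝ → ℝ) (hΩ : ContDiff ℝ 1 (fun p : ℝ × ℝ => Ω p.1 p.2))
    (s : ℝ) (hs : s = 1 ∨ s = -1)
    (φ : ℝ → ℝ → ℝ → ℝ)
    (hφ : ContDiff ℝ 3 (fun p : ℝ × ℝ × ℝ => φ p.1 p.2.1 p.2.2))
    (heik : ∀ x t κ : ℝ, deriv (fun t' => φ x t' κ) t
      = s * Ω t (κ - deriv (fun x' => φ x' t κ) x))
    (K : ℝ → ℝ → ℝ) (hK : Differentiable ℝ (fun p : ℝ × ℝ => K p.1 p.2))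
    (hstat : ∀ x t : ℝ, deriv (fun κ' => φ x t κ') (K x t) = x)
    (hnd : ∀ x t : ℝ,
      deriv (fun κ' => deriv (fun κ'' => φ x t κ'') κ') (K x t) ≠ 0)
    (kh : ℝ → ℝ → ℝ)
    (hkh : ∀ x t : ℝ, kh x t = K x t - deriv (fun x' => φ x' t (K x t)) x) :
    ∀ x t : ℝ,
      deriv (fun t' => kh x t') t
        + s * deriv (fun ξ => Ω t ξ) (kh x t) * deriv (fun x' => kh x' t) x = 0 := by
  intro x t
  have hφ2 : ContDiff ℝ 2 (fun p : ℝ × ℝ × ℝ => φ p.1 p.2.1 p.2.2) := hφ.of_le (by norm_num)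
  set F : ℝ × ℝ × ℝ → ℝ := fun p => φ p.1 p.2.1 p.2.2
  have hF : Differentiable ℝ F := hφ.differentiable (by norm_num)
  have cx (x t κ : ℝ) : HasDerivAt (fun x' : ℝ => (x', t, κ)) (1, 0, 0) x :=
    (hasDerivAt_id x).prodMk (hasDerivAt_const x (t, κ))
  have ct (x t κ : ℝ) : HasDerivAt (fun t' : ℝ => (x, t', κ)) (0, 1, 0) t :=
    (hasDerivAt_const t x).prodMk ((hasDerivAt_id t).prodMk (hasDerivAt_const t κ))
  have cκ (x t κ : ℝ) : HasDerivAt (fun κ' : ℝ => (x, t, κ')) (0, 0, 1) κ :=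
    (hasDerivAt_const κ x).prodMk ((hasDerivAt_const κ t).prodMk (hasDerivAt_id κ))
  have dx (x t κ : ℝ) : deriv (fun x' => φ x' t κ) x = fderiv ℝ F (x, t, κ) (1, 0, 0) :=
    HasDerivAt.deriv (HasFDerivAt.comp_hasDerivAt (l := F) x (hF (x, t, κ)).hasFDerivAt (cx x t κ))
  have dt (x t κ : ℝ) : deriv (fun t' => φ x t' κ) t = fderiv ℝ F (x, t, κ) (0, 1, 0) :=
    HasDerivAt.deriv (HasFDerivAt.comp_hasDerivAt (l := F) t (hF (x, t, κ)).hasFDerivAt (ct x t κ))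
  have dκ (x t κ : ℝ) : deriv (fun κ' => φ x t κ') κ = fderiv ℝ F (x, t, κ) (0, 0, 1) :=
    HasDerivAt.deriv (HasFDerivAt.comp_hasDerivAt (l := F) κ (hF (x, t, κ)).hasFDerivAt (cκ x t κ))
  simp only [dx, dt, dκ] at heik hstat hnd hkh
  have hnd0 := hnd x t
  rw [(hasDerivAt_fderiv_apply_comp hφ2 (cκ x t (K x t)) (0, 0, 1)).deriv] at hnd0
  have hsymm : IsSymmSndFDerivAt ℝ F (x, t, K x t) :=
    hφ2.contDiffAt.isSymmSndFDerivAt (by simp)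
  have hxt := hsymm.eq (1, 0, 0) (0, 1, 0)
  have hxκ := hsymm.eq (1, 0, 0) (0, 0, 1)
  have htκ := hsymm.eq (0, 1, 0) (0, 0, 1)
  -- derivatives of the local quasimomentum
  obtain ⟨Kx, hKx⟩ : ∃ Kx, HasDerivAt (fun x' => K x' t) Kx x :=
    ⟨_, (DifferentiableAt.comp (g := fun p : ℝ × ℝ => K p.1 p.2)
      (f := fun x' : ℝ => (x', t)) x (hK (x, t))
      (differentiableAt_id.prodMk (differentiableAt_const t))).hasDerivAt⟩
  obtain ⟨Kt, hKt⟩ : ∃ Kt, HasDerivAt (fun t' => K x t') Kt t :=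
    ⟨_, (DifferentiableAt.comp (g := fun p : ℝ × ℝ => K p.1 p.2)
      (f := fun t' : ℝ => (x, t')) t (hK (x, t))
      ((differentiableAt_const x).prodMk differentiableAt_id)).hasDerivAt⟩
  have gx : HasDerivAt (fun x' : ℝ => (x', t, K x' t)) (1, 0, Kx) x :=
    (hasDerivAt_id x).prodMk ((hasDerivAt_const x t).prodMk hKx)
  have gt : HasDerivAt (fun t' : ℝ => (x, t', K x t')) (0, 1, Kt) t :=
    (hasDerivAt_const t x).prodMk ((hasDerivAt_id t).prodMk hKt)
  have ex : ((1, 0, Kx) : ℝ × ℝ × ℝ) = (1, 0, 0) + Kx • (0, 0, 1) := by simp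
  have et : ((0, 1, Kt) : ℝ × ℝ × ℝ) = (0, 1, 0) + Kt • (0, 0, 1) := by simp
  -- the stationarity condition, differentiated in `x` and `t`
  have sx := hasDerivAt_fderiv_apply_comp hφ2 gx (0, 0, 1)
  simp only [hstat] at sx
  have sx := sx.unique (hasDerivAt_id x)
  have st := hasDerivAt_fderiv_apply_comp hφ2 gt (0, 0, 1)
  simp only [hstat] at st
  have st := st.unique (hasDerivAt_const t x)
  -- the local wavenumber, differentiated in `x` and `t`
  have kx := hKx.fun_sub (hasDerivAt_fderiv_apply_comp hφ2 gx (1, 0, 0))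
  simp only [← hkh] at kx
  have kt := hKt.fun_sub (hasDerivAt_fderiv_apply_comp hφ2 gt (1, 0, 0))
  simp only [← hkh] at kt
  -- the eikonal equation, differentiated in `x` and `κ`
  have hΩξ : HasDerivAt (fun ξ => Ω t ξ) (deriv (fun ξ => Ω t ξ) (kh x t)) (kh x t) :=
    (((hΩ.differentiable (by norm_num)) (t, kh x t)).comp (kh x t)
      ((differentiableAt_const t).prodMk differentiableAt_id)).hasDerivAt
  rw [kx.deriv, kt.deriv]
  set c := deriv (fun ξ => Ω t ξ) (kh x t)
  rw [hkh] at hΩξ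
  have eκ := hasDerivAt_fderiv_apply_comp hφ2 (cκ x t (K x t)) (0, 1, 0)
  simp only [heik] at eκ
  have eκ := eκ.unique ((hΩξ.comp (K x t) ((hasDerivAt_id (K x t)).sub
    (hasDerivAt_fderiv_apply_comp hφ2 (cκ x t (K x t)) (1, 0, 0)))).const_mul s)
  have ex' := hasDerivAt_fderiv_apply_comp hφ2 (cx x t (K x t)) (0, 1, 0)
  simp only [heik] at ex'
  have ex' := ex'.unique ((hΩξ.comp x
    ((hasDerivAt_fderiv_apply_comp hφ2 (cx x t (K x t)) (1, 0, 0)).const_sub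
      (K x t))).const_mul s)
  simp only [ex, et, map_add, map_smul, add_apply, smul_apply, smul_eq_mul] at sx st ⊢
  have key : Kt + s * c * Kx = 0 := by
    refine (mul_eq_zero.mp ?_).resolve_left hnd0
    linear_combination st + s * c * sx - htκ - s * c * hxκ - eκ
  linear_combination
    (1 - fderiv ℝ (fderiv ℝ F) (x, t, K x t) (0, 0, 1) (1, 0, 0)) * key - ex' + hxt
end
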